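/- Suppose f is monotone in interference, a ≤ b componentwise in ℝᴸ, and Q* minimizes Q ↦ f(Q, a) over the sliced feasible set S_{[a,b]}. Then L_B([a,b]) ≤ inf_{Q ∈ S_{[a,b]}} f(Q, g(Q)) ≤ U_B([a,b]); in particular the bounding procedure produces a valid lower bound and a valid upper bound on the optimal value of the restricted problem over the rectangle [a,b]. -/

import Mathlib

/-- The bounding procedure of the branch-and-bound algorithm produces a valid
lower bound `L_B([a,b]) = f(Q*, a)` and upper bound `U_B([a,b]) = f(Q*, g(Q*))`
on the optimal value `inf_{Q ∈ S_{[a,b]}} f(Q, g(Q))` of the restricted problem. -/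
theorem bounding_procedure_valid {n L : ℕ}
    (S : Set (Fin n → ℝ))
    (g : (Fin n → ℝ) → (Fin L → ℝ))
    (f : (Fin n → ℝ) → (Fin L → ℝ) → ℝ)
    (hmono : ∀ (Q : Fin n → ℝ) (i i' : Fin L → ℝ), i ≤ i' → f Q i ≤ f Q i')
    (a b : Fin L → ℝ) (hab : a ≤ b)
    (Qstar : Fin n → ℝ)
    (hQmem : Qstar ∈ {Q ∈ S | a ≤ g Q ∧ g Q ≤ b})
    (hQmin : ∀ Q ∈ {Q ∈ S | a ≤ g Q ∧ g Q ≤ b}, f Qstar a ≤ f Q a) :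
    f Qstar a ≤ sInf ((fun Q => f Q (g Q)) '' {Q ∈ S | a ≤ g Q ∧ g Q ≤ b}) ∧
      sInf ((fun Q => f Q (g Q)) '' {Q ∈ S | a ≤ g Q ∧ g Q ≤ b}) ≤
        f Qstar (g Qstar) := by
  have hlower : ∀ y ∈ (fun Q => f Q (g Q)) '' {Q ∈ S | a ≤ g Q ∧ g Q ≤ b},
      f Qstar a ≤ y := by
    rintro _ ⟨Q, hQ, rfl⟩
    exact (hQmin Q hQ).trans (hmono Q a (g Q) hQ.2.1)
  have hmem := Set.mem_image_of_mem (fun Q => f Q (g Q)) hQmem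
  exact ⟨le_csInf ⟨_, hmem⟩ hlower, csInf_le ⟨_, hlower⟩ hmem⟩
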